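/- arXiv:1708.00877 — 2 statements merged into one kernel-verified Lean document; each statement's English description precedes it below -/
import Mathlib

section
/- Let H_∞ := {x ∈ (S¹)^ℕ : x_i ∈ {1, −1} for all but at most one index i} and H₀ := {y ∈ (S¹)^ℕ : y_i = 1 for all but at most one index i}, and let p_∞ : H_∞ → H₀ be the componentwise squaring map. The group of deck transformations of p_∞, i.e., the group (under composition) of self-homeomorphisms h : H_∞ → H_∞ satisfying p_∞ ∘ h = p_∞, is isomorphic to the direct product of countably many copies of ℤ/2, i.e., to the group (ℤ/2)^ℕ. -/
/-- The Hawaiian-earring-like subspace `H₀` of `(S¹)^ℕ`: sequences equal to `1` at all but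
at most one index. -/
def Hzero : Set (ℕ → Circle) := {y | {i | y i ≠ 1}.Subsingleton}

/-- The space `H_∞`: sequences in `(S¹)^ℕ` with all but at most one coordinate in `{1, -1}`. -/
def Hinf : Set (ℕ → Circle) := {x | {i | x i ≠ 1 ∧ (x i : ℂ) ≠ -1}.Subsingleton}

lemma sq_eq_one_of {z : Circle} (hz : z = 1 ∨ (z : ℂ) = -1) : z ^ 2 = 1 := by
  rcases hz with h | h
  · rw [h, one_pow]
  · have h2 : ((z ^ 2 : Circle) : ℂ) = (z : ℂ) ^ 2 := by norm_cast
    apply Circle.coe_injective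
    rw [h2, h]
    norm_num

lemma Hinf_exists_j {x : ℕ → Circle} (hx : x ∈ Hinf) :
    ∃ j : ℕ, ∀ i, i ≠ j → (x i = 1 ∨ (x i : ℂ) = -1) := by
  by_cases h : ∃ j, x j ≠ 1 ∧ (x j : ℂ) ≠ -1
  · obtain ⟨j, hj⟩ := h
    refine ⟨j, fun i hij => ?_⟩
    by_contra hc
    push_neg at hc
    exact hij (hx hc hj)
  · push_neg at h
    refine ⟨0, fun i _ => ?_⟩
    by_contra hc
    push_neg at hc
    exact hc.2 (h i hc.1)

/-- The componentwise squaring map `p_∞ : H_∞ → H₀`. -/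
noncomputable def pinf (x : ↥Hinf) : ↥Hzero :=
  ⟨fun i => x.1 i ^ 2, by
    obtain ⟨j, hj⟩ := Hinf_exists_j x.2
    refine (Set.subsingleton_singleton (a := j)).anti ?_
    intro i hi
    simp only [Set.mem_setOf_eq] at hi
    simp only [Set.mem_singleton_iff]
    by_contra hij
    exact hi (sq_eq_one_of (hj i hij))⟩

/-- The group of deck transformations of `p_∞`: self-homeomorphisms of `H_∞`
commuting with `p_∞`, under composition. -/
def DeckGroup : Type := {h : ↥Hinf ≃ₜ ↥Hinf // ∀ x, pinf (h x) = pinf x}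

noncomputable instance : Group DeckGroup where
  mul a b := ⟨b.1.trans a.1, fun x => by
    show pinf (a.1 (b.1 x)) = pinf x
    rw [a.2, b.2]⟩
  one := ⟨Homeomorph.refl _, fun _ => rfl⟩
  inv a := ⟨a.1.symm, fun x => by
    conv_rhs => rw [← a.1.apply_symm_apply x]
    exact (a.2 (a.1.symm x)).symm⟩
  mul_assoc a b c := Subtype.ext (Homeomorph.ext fun _ => rfl)
  one_mul a := Subtype.ext (Homeomorph.ext fun _ => rfl)
  mul_one a := Subtype.ext (Homeomorph.ext fun _ => rfl)
  inv_mul_cancel a := Subtype.ext (Homeomorph.ext fun x => a.1.symm_apply_apply x)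

lemma Circle.sq_eq_one_iff (z : Circle) : z ^ 2 = 1 ↔ z = 1 ∨ (z : ℂ) = -1 := by
  refine ⟨fun h => ?_, sq_eq_one_of⟩
  have h2 : (z : ℂ) ^ 2 = 1 := by exact_mod_cast congrArg ((↑) : Circle → ℂ) h
  rcases mul_self_eq_one_iff.mp (pow_two (z : ℂ) ▸ h2) with h3 | h3
  · exact Or.inl (Circle.ext h3)
  · exact Or.inr h3

lemma ZMod.toCircle_sq (a : ZMod 2) : ZMod.toCircle a ^ 2 = 1 := by
  rw [pow_two, ← AddChar.map_add_eq_mul, CharTwo.add_self_eq_zero, AddChar.map_zero_eq_one]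

lemma ZMod.exists_toCircle_eq {z : Circle} (hz : z ^ 2 = 1) :
    ∃ a : ZMod 2, ZMod.toCircle a = z := by
  rcases (Circle.sq_eq_one_iff z).mp hz with h | h
  · exact ⟨0, by rw [h, AddChar.map_zero_eq_one]⟩
  · refine ⟨1, ?_⟩
    rcases (Circle.sq_eq_one_iff _).mp (ZMod.toCircle_sq 1) with h1 | h1
    · rw [← AddChar.map_zero_eq_one (ZMod.toCircle (N := 2))] at h1
      exact absurd (ZMod.injective_toCircle h1) one_ne_zero
    · exact Circle.ext (h1.trans h.symm)

lemma mem_Hinf_iff {x : ℕ → Circle} : x ∈ Hinf ↔ ∃ j, ∀ i, i ≠ j → x i ^ 2 = 1 := by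
  constructor
  · intro hx
    obtain ⟨j, hj⟩ := Hinf_exists_j hx
    exact ⟨j, fun i hi => sq_eq_one_of (hj i hi)⟩
  · rintro ⟨j, hj⟩
    refine (Set.subsingleton_singleton (a := j)).anti fun i hi => ?_
    by_contra hij
    rcases (Circle.sq_eq_one_iff _).mp (hj i hij) with h | h
    · exact hi.1 h
    · exact hi.2 h

/-- The map `H_∞ → H_∞` multiplying the coordinates by signs. -/
noncomputable def signMap (a : ℕ → ZMod 2) (x : ↥Hinf) : ↥Hinf :=
  ⟨fun i => ZMod.toCircle (a i) * x.1 i, by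
    obtain ⟨j, hj⟩ := mem_Hinf_iff.mp x.2
    exact mem_Hinf_iff.mpr ⟨j, fun i hi => by rw [mul_pow, ZMod.toCircle_sq, hj i hi, one_mul]⟩⟩

lemma signMap_add (a b : ℕ → ZMod 2) (x : ↥Hinf) :
    signMap (a + b) x = signMap a (signMap b x) := by
  ext i : 2
  simp only [signMap, Pi.add_apply, AddChar.map_add_eq_mul, mul_assoc]

lemma signMap_signMap (a : ℕ → ZMod 2) (x : ↥Hinf) : signMap a (signMap a x) = x := by
  ext i : 2
  simp only [signMap, ← mul_assoc, ← pow_two, ZMod.toCircle_sq, one_mul]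

lemma continuous_signMap (a : ℕ → ZMod 2) : Continuous (signMap a) := by
  refine Continuous.subtype_mk (continuous_pi fun i => ?_) _
  exact continuous_const.mul ((continuous_apply i).comp continuous_subtype_val)

/-- Sign changes of the coordinates, as a homomorphism to the group of deck transformations. -/
noncomputable def deckSignHom : Multiplicative (ℕ → ZMod 2) →* DeckGroup :=
  MonoidHom.mk'
    (fun a => ⟨{  toFun := signMap a.toAdd
                  invFun := signMap a.toAdd
                  left_inv := signMap_signMap _
                  right_inv := signMap_signMap _
                  continuous_toFun := continuous_signMap _
                  continuous_invFun := continuous_signMap _ }, fun x => by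
      refine Subtype.ext (funext fun i => ?_)
      change (ZMod.toCircle (a.toAdd i) * x.1 i) ^ 2 = x.1 i ^ 2
      rw [mul_pow, ZMod.toCircle_sq, one_mul]⟩)
    fun a b => Subtype.ext (Homeomorph.ext fun x => signMap_add _ _ x)

lemma deckSignHom_apply (a : Multiplicative (ℕ → ZMod 2)) (x : ↥Hinf) (i : ℕ) :
    ((deckSignHom a).1 x).1 i = ZMod.toCircle (a.toAdd i) * x.1 i := rfl

lemma one_mem_Hinf : (1 : ℕ → Circle) ∈ Hinf :=
  mem_Hinf_iff.mpr ⟨0, fun _ _ => one_pow 2⟩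

lemma deckSignHom_injective : Function.Injective deckSignHom := by
  intro a b h
  refine Multiplicative.toAdd.injective (funext fun i => ?_)
  have h1 : ((deckSignHom a).1 ⟨1, one_mem_Hinf⟩).1 i =
      ((deckSignHom b).1 ⟨1, one_mem_Hinf⟩).1 i := by
    rw [h]
  simp only [deckSignHom_apply, Pi.one_apply, mul_one] at h1
  exact ZMod.injective_toCircle h1

lemma update_mem_Hinf {y : ℕ → Circle} {j : ℕ} (hy : ∀ i, i ≠ j → y i ^ 2 = 1) (z : Circle) :
    Function.update y j z ∈ Hinf :=
  mem_Hinf_iff.mpr ⟨j, fun i hi => by rw [Function.update_of_ne hi, hy i hi]⟩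

/-- Points of `H_∞` differing only in the free coordinate lie in one connected component. -/
lemma update_mem_connectedComponent {y : ℕ → Circle} {j : ℕ} (hy : ∀ i, i ≠ j → y i ^ 2 = 1)
    (z w : Circle) : (⟨Function.update y j z, update_mem_Hinf hy z⟩ : ↥Hinf) ∈
      connectedComponent (⟨Function.update y j w, update_mem_Hinf hy w⟩ : ↥Hinf) := by
  let f : Circle → ↥Hinf := fun u => ⟨Function.update y j u, update_mem_Hinf hy u⟩
  have hf : Continuous f :=
    ((continuous_const (y := y)).update j continuous_id).subtype_mk (update_mem_Hinf hy)
  exact (isPreconnected_range hf).subset_connectedComponent ⟨w, rfl⟩ ⟨z, rfl⟩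

lemma mem_connectedComponent_one_of_sq {x : ↥Hinf} (hx : ∀ i, x.1 i ^ 2 = 1) :
    x ∈ connectedComponent (⟨1, one_mem_Hinf⟩ : ↥Hinf) := by
  let t : ℕ → ℕ → Circle := fun n i => if i < n then x.1 i else 1
  have htsq (n i : ℕ) : t n i ^ 2 = 1 := by
    simp only [t]
    split_ifs
    exacts [hx i, one_pow 2]
  have ht (n : ℕ) : t n ∈ Hinf := mem_Hinf_iff.mpr ⟨0, fun i _ => htsq n i⟩
  have hcomp (n : ℕ) : (⟨t n, ht n⟩ : ↥Hinf) ∈ connectedComponent (⟨1, one_mem_Hinf⟩ : ↥Hinf) := by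
    induction n with
    | zero =>
      convert mem_connectedComponent using 1
      exact Subtype.ext (funext fun i => by simp [t])
    | succ n ih =>
      rw [connectedComponent_eq ih]
      convert update_mem_connectedComponent (y := t n) (j := n) (fun i _ => htsq n i) (x.1 n)
        (t n n) using 2
      · exact Subtype.ext (Function.update_eq_self n (t n)).symm
      · funext i
        rcases eq_or_ne i n with rfl | hi
        · simp [t]
        · simp only [t, Function.update_of_ne hi]
          congr 1
          apply propext
          omega
  refine isClosed_connectedComponent.mem_of_tendsto (f := fun n => (⟨t n, ht n⟩ : ↥Hinf))
    (b := Filter.atTop) ?_ (Filter.Eventually.of_forall hcomp)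
  rw [tendsto_subtype_rng, tendsto_pi_nhds]
  intro i
  refine tendsto_const_nhds.congr' ?_
  filter_upwards [Filter.eventually_gt_atTop i] with n hn
  simp [t, hn]

instance : PreconnectedSpace ↥Hinf := by
  refine ⟨?_⟩
  suffices h : connectedComponent (⟨1, one_mem_Hinf⟩ : ↥Hinf) = Set.univ from
    h ▸ isPreconnected_connectedComponent
  refine Set.eq_univ_of_forall fun x => ?_
  obtain ⟨j, hj⟩ := mem_Hinf_iff.mp x.2
  have h1 : (⟨Function.update x.1 j 1, update_mem_Hinf hj 1⟩ : ↥Hinf) ∈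
      connectedComponent (⟨1, one_mem_Hinf⟩ : ↥Hinf) := by
    refine mem_connectedComponent_one_of_sq fun i => ?_
    rcases eq_or_ne i j with rfl | hi
    · simp
    · simpa [Function.update_of_ne hi] using hj i hi
  rw [connectedComponent_eq h1]
  simpa using update_mem_connectedComponent hj (x.1 j) 1

lemma deckSignHom_surjective : Function.Surjective deckSignHom := by
  intro h
  let ε : ℕ → ↥Hinf → Circle := fun i x => (h.1 x).1 i / x.1 i
  have hε (i : ℕ) : Continuous (ε i) := by
    have hi : Continuous fun x : ↥Hinf => x.1 i :=
      (continuous_apply i).comp continuous_subtype_val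
    exact (hi.comp h.1.continuous).div' hi
  have hsq (i : ℕ) (x : ↥Hinf) : ε i x ^ 2 = 1 := by
    have h1 : (h.1 x).1 i ^ 2 = x.1 i ^ 2 := congrFun (congrArg Subtype.val (h.2 x)) i
    rw [div_pow, h1, div_self']
  let one : ↥Hinf := ⟨1, one_mem_Hinf⟩
  have hconst (i : ℕ) (x : ↥Hinf) : ε i x = ε i one :=
    isPreconnected_univ.constant_of_mapsTo (T := Set.range (ZMod.toCircle (N := 2)))
      (Set.finite_range _).isDiscrete (hε i).continuousOn
      (fun y _ => ZMod.exists_toCircle_eq (hsq i y))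
      (Set.mem_univ x) (Set.mem_univ one)
  choose a ha using fun i => ZMod.exists_toCircle_eq (hsq i one)
  refine ⟨Multiplicative.ofAdd a, Subtype.ext (Homeomorph.ext fun x => ?_)⟩
  refine Subtype.ext (funext fun i => ?_)
  rw [deckSignHom_apply, toAdd_ofAdd, ha, ← hconst i x]
  exact div_mul_cancel _ _

/-- The group of deck transformations of the squaring lifting space `p_∞ : H_∞ → H₀`
is isomorphic to `(ℤ/2)^ℕ`. -/
theorem stmt_12 : Nonempty (DeckGroup ≃* Multiplicative (ℕ → ZMod 2)) :=
  ⟨(MulEquiv.ofBijective deckSignHom ⟨deckSignHom_injective, deckSignHom_surjective⟩).symm⟩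
end

section
/- Let H_∞ := {x ∈ (S¹)^ℕ : x_i ∈ {1, −1} for all but at most one index i} and H₀ := {y ∈ (S¹)^ℕ : y_i = 1 for all but at most one index i}, and let p_∞ : H_∞ → H₀ be the componentwise squaring map. Then p_∞ is injective on fundamental groups: if γ is a loop in H_∞ based at a point e, and the loop p_∞ ∘ γ in H₀ is null-homotopic relative to its endpoints, then γ is null-homotopic in H_∞ relative to its endpoints. -/
lemma pinf_continuous : Continuous pinf := by
  apply Continuous.subtype_mk
  exact continuous_pi fun i => ((continuous_apply i).comp continuous_subtype_val).pow 2

lemma Circle.coe_eq_one_or_neg_one_of_sq_eq_one {z : Circle} (hz : z ^ 2 = 1) :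
    (z : ℂ) = 1 ∨ (z : ℂ) = -1 := by
  simpa using congrArg (fun w : Circle => (w : ℂ)) hz

lemma Circle.isCoveringMap_sq : IsCoveringMap (fun z : Circle => z ^ 2) := by
  have hcont : Continuous (fun z : Circle => z ^ 2) := continuous_id.pow 2
  have hsurj : Function.Surjective (fun z : Circle => z ^ 2) := fun z => by
    refine ⟨Circle.exp (Complex.arg z / 2), ?_⟩
    change Circle.exp _ ^ 2 = z
    rw [sq, ← Circle.exp_add, add_halves, Circle.exp_arg]
  have hquot : Topology.IsQuotientMap (powMonoidHom 2 : Circle →* Circle) :=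
    hcont.isClosedMap.isQuotientMap hcont hsurj
  refine (hquot.isQuotientCoveringMap_of_isDiscrete_ker_monoidHom
    (f := (powMonoidHom 2 : Circle →* Circle)) (Set.Finite.isDiscrete ?_)).isCoveringMap
  refine (((Set.finite_singleton (-1 : ℂ)).insert 1).preimage
    Circle.coe_injective.injOn).subset fun z hz => ?_
  exact Circle.coe_eq_one_or_neg_one_of_sq_eq_one hz

lemma mem_Hinf_of_sq_mem_Hzero {x : ℕ → Circle} (hx : (fun i => x i ^ 2) ∈ Hzero) :
    x ∈ Hinf := by
  refine Set.Subsingleton.anti hx fun i ⟨h, h'⟩ hi => ?_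
  rcases Circle.coe_eq_one_or_neg_one_of_sq_eq_one hi with h₁ | h₁
  · exact h (Circle.coe_eq_one.mp h₁)
  · exact h' h₁

/-- `p_∞` is injective on fundamental groups: a loop in `H_∞` whose image in `H₀` is
null-homotopic rel endpoints is itself null-homotopic rel endpoints. -/
theorem stmt_14 (e : ↥Hinf) (γ : Path e e)
    (h : (γ.map pinf_continuous).Homotopic (Path.refl (pinf e))) :
    γ.Homotopic (Path.refl e) := by
  obtain ⟨F⟩ := h
  let coord (i : ℕ) : C(Hinf, Circle) :=
    ⟨fun x => x.1 i, (continuous_apply i).comp continuous_subtype_val⟩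
  let coord₀ (i : ℕ) : C(Hzero, Circle) :=
    ⟨fun y => y.1 i, (continuous_apply i).comp continuous_subtype_val⟩
  let G (i : ℕ) := Circle.isCoveringMap_sq.liftHomotopyRel (F.compContinuousMap (coord₀ i))
    (f₀' := (coord i).comp γ.toContinuousMap)
    (f₁' := (coord i).comp (Path.refl e).toContinuousMap)
    ⟨0, Or.inl rfl, by simp⟩ rfl rfl
  have hG (i : ℕ) (a) : G i a ^ 2 = (F a).1 i :=
    congrFun (Circle.isCoveringMap_sq.liftHomotopy_lifts
      (F.compContinuousMap (coord₀ i)).toContinuousMap ((coord i).comp γ.toContinuousMap)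
      fun t => (F.compContinuousMap (coord₀ i)).apply_zero t) a
  refine ⟨{
    toFun a := ⟨fun i => G i a, mem_Hinf_of_sq_mem_Hzero ?_⟩
    continuous_toFun := Continuous.subtype_mk (continuous_pi fun i => (G i).continuous) _
    map_zero_left t := Subtype.ext (funext fun i => (G i).apply_zero t)
    map_one_left t := Subtype.ext (funext fun i => (G i).apply_one t)
    prop' s t ht := Subtype.ext (funext fun i => (G i).eq_fst s ht) }⟩
  simp_rw [hG]
  exact (F a).2
end
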